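/- Let γ ∈ ℝ with γ ≠ 0. There exists a constant C > 0 such that for every smooth function u : ℝ × ℝ → ℂ, 2π-periodic in the second variable x and compactly supported in the first variable t: (i) ( ∫_ℝ ∫_0^{2π} |u(t,x)|⁴ dx dt )^{1/4} ≤ C ( Σ_{n∈ℤ} ∫_ℝ ⟨τ+n²⟩^{3/4} |û(τ,n)|² dτ )^{1/2}, and (ii) ( ∫_ℝ ∫_0^{2π} |u(t,x)|⁴ dx dt )^{1/4} ≤ C ( Σ_{n∈ℤ} ∫_ℝ ⟨τ+γ|n|n⟩^{3/4} |û(τ,n)|² dτ )^{1/2}. -/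

import Mathlib

open MeasureTheory ENNReal

/-- Japanese bracket `⟨x⟩ = 1 + |x|`. -/
noncomputable def jb (x : ℝ) : ℝ := 1 + |x|

/-- Space-time Fourier transform of a function `u(t,x)` which is `2π`-periodic in `x`:
Fourier series in `x`, Fourier integral in `t`:
`û(τ,n) = (2π)⁻¹ ∫_ℝ ∫_0^{2π} u(t,x) e^{-i(nx+tτ)} dx dt`. -/
noncomputable def ftper (u : ℝ × ℝ → ℂ) (τ : ℝ) (n : ℤ) : ℂ :=
  (2 * Real.pi : ℂ)⁻¹ *
    ∫ t : ℝ, ∫ x in (0 : ℝ)..(2 * Real.pi),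
      u (t, x) * Complex.exp (-Complex.I * (((n : ℝ) * x + t * τ : ℝ) : ℂ))


lemma cs_sq {α : Type*} [MeasurableSpace α] (μ : Measure α) (f g : α → ℝ≥0∞)
    (hf : AEMeasurable f μ) (hg : AEMeasurable g μ) :
    (∫⁻ x, f x * g x ∂μ) ^ 2 ≤ (∫⁻ x, f x ^ 2 ∂μ) * (∫⁻ x, g x ^ 2 ∂μ) := by
  have h := ENNReal.lintegral_mul_le_Lp_mul_Lq μ (p := 2) (q := 2)
    (by constructor <;> norm_num) hf hg
  have h2 := pow_le_pow_left₀ (zero_le) h 2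
  simp only [Pi.mul_apply] at h2
  refine h2.trans (le_of_eq ?_)
  rw [mul_pow, ← ENNReal.rpow_natCast, ← ENNReal.rpow_natCast, ← ENNReal.rpow_mul,
    ← ENNReal.rpow_mul]
  norm_num

lemma cs_half {α : Type*} [MeasurableSpace α] (μ : Measure α) (f g : α → ℝ≥0∞)
    (hf : AEMeasurable f μ) (hg : AEMeasurable g μ) :
    (∫⁻ x, f x * g x ∂μ) ≤ (∫⁻ x, f x ^ 2 ∂μ) ^ (1/2 : ℝ) * (∫⁻ x, g x ^ 2 ∂μ) ^ (1/2 : ℝ) := by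
  have h := ENNReal.lintegral_mul_le_Lp_mul_Lq μ (p := 2) (q := 2)
    (by constructor <;> norm_num) hf hg
  simpa using h

lemma mink {α ι : Type*} [Countable ι] [MeasurableSpace α] (μ : Measure α) (a : ι → α → ℝ≥0∞)
    (ha : ∀ i, Measurable (a i)) :
    (∫⁻ x, (∑' i, a i x) ^ 2 ∂μ) ≤ (∑' i, (∫⁻ x, a i x ^ 2 ∂μ) ^ (1/2 : ℝ)) ^ 2 := by
  have h1 : ∀ x, (∑' i, a i x) ^ 2 = ∑' i, ∑' j, a i x * a j x := by
    intro x
    rw [sq, ← ENNReal.tsum_mul_right]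
    simp_rw [ENNReal.tsum_mul_left]
  have hm : ∀ i j, Measurable fun x => a i x * a j x := fun i j => (ha i).mul (ha j)
  simp_rw [h1]
  rw [lintegral_tsum (fun i => (Measurable.tsum fun j => hm i j).aemeasurable)]
  rw [sq, ← ENNReal.tsum_mul_right]
  refine ENNReal.tsum_le_tsum fun i => ?_
  rw [lintegral_tsum (fun j => (hm i j).aemeasurable), ← ENNReal.tsum_mul_left]
  exact ENNReal.tsum_le_tsum fun j => cs_half μ _ _ (ha i).aemeasurable (ha j).aemeasurable

lemma conv_L2 {G : Type*} [AddCommGroup G] [MeasurableSpace G] [MeasurableAdd₂ G] [MeasurableNeg G]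
    (μ : Measure G) [SFinite μ] [μ.IsAddLeftInvariant] (g h : G → ℝ≥0∞) (hg : Measurable g)
    (hh : Measurable h) (A B : Set G) (hA : MeasurableSet A) (hB : MeasurableSet B)
    (hgA : ∀ x, x ∉ A → g x = 0) (hhB : ∀ x, x ∉ B → h x = 0) (K : ℝ≥0∞)
    (hK : ∀ ξ, μ {η | η ∈ A ∧ ξ - η ∈ B} ≤ K) :
    ∫⁻ ξ, (∫⁻ η, g η * h (ξ - η) ∂μ) ^ 2 ∂μ ≤ K * ((∫⁻ ξ, g ξ ^ 2 ∂μ) * (∫⁻ ξ, h ξ ^ 2 ∂μ)) := by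
  have hsub : Measurable fun p : G × G => p.1 - p.2 := by
    simp_rw [sub_eq_add_neg]; fun_prop
  have hsub' : ∀ ξ : G, Measurable fun p : G => ξ - p := fun ξ => by
    simp_rw [sub_eq_add_neg]; fun_prop
  have key : ∀ ξ, (∫⁻ η, g η * h (ξ - η) ∂μ) ^ 2 ≤ K * ∫⁻ η, g η ^ 2 * h (ξ - η) ^ 2 ∂μ := by
    intro ξ
    set E : Set G := {η | η ∈ A ∧ ξ - η ∈ B}
    have hE : MeasurableSet E := hA.inter (hsub' ξ hB)
    have : ∀ η, g η * h (ξ - η) = E.indicator 1 η * (g η * h (ξ - η)) := by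
      intro η
      by_cases hη : η ∈ E
      · simp [hη]
      · have : g η = 0 ∨ h (ξ - η) = 0 := by
          by_contra hc
          push Not at hc
          exact hη ⟨by by_contra h'; exact hc.1 (hgA _ h'), by by_contra h'; exact hc.2 (hhB _ h')⟩
        rcases this with h' | h' <;> simp [h']
    rw [lintegral_congr this]
    refine (cs_sq μ _ _ (by exact (measurable_one.indicator hE).aemeasurable)
      (hg.mul (hh.comp (hsub' ξ))).aemeasurable).trans ?_
    simp only [Pi.mul_apply, Function.comp, mul_pow]
    gcongr
    refine le_trans (le_of_eq ?_) (hK ξ)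
    rw [← lintegral_indicator_one hE]
    congr 1
    ext η
    by_cases hη : η ∈ E <;> simp [hη]
  refine (lintegral_mono key).trans ?_
  have hm : Measurable (fun p : G × G => g p.2 ^ 2 * h (p.1 - p.2) ^ 2) := by
    have := hh.comp hsub
    exact ((hg.comp measurable_snd).pow_const 2).mul (this.pow_const 2)
  rw [lintegral_const_mul _ (Measurable.lintegral_prod_right' hm)]
  gcongr
  rw [lintegral_lintegral_swap hm.aemeasurable]
  refine le_of_eq ?_
  rw [← lintegral_mul_const _ (hg.pow_const 2)]
  refine lintegral_congr fun η => ?_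
  have h3 : Measurable fun ξ => h (ξ - η) ^ 2 := by
    refine (hh.comp ?_).pow_const 2
    simp_rw [sub_eq_add_neg]; fun_prop
  dsimp only
  rw [lintegral_const_mul _ h3]
  congr 1
  exact lintegral_sub_right_eq_self (fun x => h x ^ 2) η

lemma count_le_of_diam (T : Set ℤ) (D : ℝ) (hD : 0 ≤ D)
    (h : ∀ x ∈ T, ∀ y ∈ T, |(x : ℝ) - y| ≤ D) : Measure.count T ≤ ENNReal.ofReal (2 * D + 1) := by
  rcases T.eq_empty_or_nonempty with rfl | ⟨x, hx⟩
  · simp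
  have hsub : T ⊆ (Finset.Icc (x - ⌊D⌋) (x + ⌊D⌋) : Finset ℤ) := by
    intro y hy
    have h1 := abs_le.1 (h y hy x hx)
    simp only [Finset.coe_Icc, Set.mem_Icc]
    have h2 : y - x ≤ ⌊D⌋ := Int.le_floor.2 (by push_cast; linarith)
    have h3 : x - y ≤ ⌊D⌋ := Int.le_floor.2 (by push_cast; linarith)
    constructor <;> linarith
  refine (measure_mono hsub).trans ?_
  rw [Measure.count_apply_finset, Int.card_Icc, ← ENNReal.ofReal_natCast]
  apply ENNReal.ofReal_le_ofReal
  have h0 : 0 ≤ ⌊D⌋ := Int.floor_nonneg.2 hD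
  have h4 : (((x + ⌊D⌋ + 1 - (x - ⌊D⌋)).toNat : ℤ) : ℝ) = 2 * ⌊D⌋ + 1 := by
    rw [Int.toNat_of_nonneg (by linarith)]; push_cast; ring
  have h5 := Int.floor_le D
  rw [Int.cast_natCast] at h4
  linarith

lemma count_quad (a : ℝ) (ha : a ≠ 0) (n : ℤ) (τ M : ℝ) (hM : 1 ≤ M) :
    Measure.count {k : ℤ | |τ + a * ((k : ℝ) ^ 2 + ((n : ℝ) - k) ^ 2)| ≤ M} ≤
      ENNReal.ofReal ((4 * √(1 / |a|) + 2) * √M) := by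
  set T := {k : ℤ | |τ + a * ((k : ℝ) ^ 2 + ((n : ℝ) - k) ^ 2)| ≤ M}
  have ha' : 0 < |a| := abs_pos.2 ha
  set D := √(1 / |a| * M)
  have key : ∀ x ∈ T, ∀ y ∈ T, 0 ≤ (2 * (x : ℝ) - n) * (2 * (y : ℝ) - n) → |(x : ℝ) - y| ≤ D := by
    intro x hx y hy hxy
    apply Real.le_sqrt_of_sq_le
    have hx' : |τ + a * ((x : ℝ) ^ 2 + ((n : ℝ) - x) ^ 2)| ≤ M := hx
    have hy' : |τ + a * ((y : ℝ) ^ 2 + ((n : ℝ) - y) ^ 2)| ≤ M := hy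
    have h1 := (abs_sub _ _).trans (add_le_add hx' hy')
    have h2 : (τ + a * ((x : ℝ) ^ 2 + ((n : ℝ) - x) ^ 2)) - (τ + a * ((y : ℝ) ^ 2 + ((n : ℝ) - y) ^ 2))
      = a * (((2 * (x : ℝ) - n) ^ 2 - (2 * (y : ℝ) - n) ^ 2) / 2) := by ring
    rw [h2, abs_mul] at h1
    have h3 : 2 * |(x : ℝ) - y| ^ 2 ≤ |((2 * (x : ℝ) - n) ^ 2 - (2 * (y : ℝ) - n) ^ 2) / 2| := by
      rw [sq_abs]
      set p := 2 * (x : ℝ) - n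
      set q := 2 * (y : ℝ) - n
      have e : (x : ℝ) - y = (p - q) / 2 := by simp only [p, q]; ring
      rw [e]
      have h5 : (p - q) ^ 2 ≤ |p ^ 2 - q ^ 2| := by
        have : p ^ 2 - q ^ 2 = (p - q) * (p + q) := by ring
        rw [this, abs_mul, ← sq_abs, sq]
        apply mul_le_mul_of_nonneg_left _ (abs_nonneg _)
        apply sq_le_sq.1
        nlinarith
      rw [abs_div, abs_two]
      nlinarith
    rw [one_div, inv_mul_eq_div, le_div_iff₀ ha']
    nlinarith
  have hD : 0 ≤ D := Real.sqrt_nonneg _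
  have hu : T ⊆ (T ∩ {x | 0 ≤ 2 * (x : ℝ) - n}) ∪ (T ∩ {x | 2 * (x : ℝ) - n ≤ 0}) := by
    intro x hx
    rcases le_total 0 (2 * (x : ℝ) - n) with h | h
    · exact Or.inl ⟨hx, h⟩
    · exact Or.inr ⟨hx, h⟩
  refine (measure_mono hu).trans ((measure_union_le _ _).trans ?_)
  have b1 := count_le_of_diam (T ∩ {x | 0 ≤ 2 * (x : ℝ) - n}) D hD
    (fun x hx y hy => key x hx.1 y hy.1 (mul_nonneg hx.2 hy.2))
  have b2 := count_le_of_diam (T ∩ {x | 2 * (x : ℝ) - n ≤ 0}) D hD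
    (fun x hx y hy => key x hx.1 y hy.1 (mul_nonneg_of_nonpos_of_nonpos hx.2 hy.2))
  refine (add_le_add b1 b2).trans ?_
  rw [← ENNReal.ofReal_add (by positivity) (by positivity)]
  apply ENNReal.ofReal_le_ofReal
  have : D = √(1 / |a|) * √M := Real.sqrt_mul (by positivity) _
  have h1 : 1 ≤ √M := Real.one_le_sqrt.2 hM
  rw [this]
  nlinarith

/-- counting times Lebesgue measure on `ℤ × ℝ` -/
noncomputable def muG : Measure (ℤ × ℝ) := (Measure.count : Measure ℤ).prod volume

instance : SFinite muG := by unfold muG; infer_instance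

instance muG_inv : muG.IsAddLeftInvariant := by
  have : (Measure.count : Measure ℤ).IsAddLeftInvariant := by
    constructor
    intro g
    ext s hs
    rw [Measure.map_apply (measurable_const_add g) hs]
    exact Measure.count_injective_image' (s := (fun x => g + x) ⁻¹' s) (f := fun x => g + x) (add_right_injective g) (MeasurableSet.of_discrete) (MeasurableSet.of_discrete) |>.symm.trans (by
      rw [Set.image_preimage_eq _ (fun y => ⟨-g + y, by simp⟩)])
  unfold muG
  infer_instance

/-- dyadic modulation region -/
def Ad (a : ℝ) (j : ℕ) : Set (ℤ × ℝ) :=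
  {p | (2 : ℝ) ^ j ≤ jb (p.2 + a * (p.1 : ℝ) ^ 2) ∧ jb (p.2 + a * (p.1 : ℝ) ^ 2) < 2 ^ (j + 1)}

lemma measurable_w (a : ℝ) : Measurable fun p : ℤ × ℝ => jb (p.2 + a * (p.1 : ℝ) ^ 2) := by
  unfold jb
  have : Measurable fun p : ℤ × ℝ => (p.1 : ℝ) := (measurable_of_countable _).comp measurable_fst
  fun_prop

lemma measurableSet_Ad (a : ℝ) (j : ℕ) : MeasurableSet (Ad a j) :=
  (measurableSet_le measurable_const (measurable_w a)).inter
    (measurableSet_lt (measurable_w a) measurable_const)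

lemma Ad_measure (a : ℝ) (ha : a ≠ 0) (j k : ℕ) (ξ : ℤ × ℝ) :
    muG {η | η ∈ Ad a j ∧ ξ - η ∈ Ad a k} ≤
      ENNReal.ofReal (8 * (4 * √(1 / |a|) + 2) * (2 ^ (min j k) * √(2 ^ (max j k)))) := by
  obtain ⟨n, τ⟩ := ξ
  set E := {η : ℤ × ℝ | η ∈ Ad a j ∧ (n, τ) - η ∈ Ad a k}
  have hE : MeasurableSet E := (measurableSet_Ad a j).inter
    ((measurable_const.sub measurable_id) (measurableSet_Ad a k))
  set M : ℝ := 2 ^ (max j k + 2)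
  set T := {k : ℤ | |τ + a * ((k : ℝ) ^ 2 + ((n : ℝ) - k) ^ 2)| ≤ M}
  set l : ℝ := 4 * 2 ^ (min j k)
  have hsl : ∀ k1 : ℤ, volume (Prod.mk k1 ⁻¹' E) ≤ T.indicator (fun _ => ENNReal.ofReal l) k1 := by
    intro k1
    have hj : ∀ t ∈ Prod.mk k1 ⁻¹' E, |t + a * (k1 : ℝ) ^ 2| ≤ 2 ^ (j + 1) := by
      intro t ht
      have := ht.1.2
      simp only [jb] at this
      linarith
    have hk : ∀ t ∈ Prod.mk k1 ⁻¹' E, |τ - t + a * ((n : ℝ) - k1) ^ 2| ≤ 2 ^ (k + 1) := by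
      intro t ht
      have := ht.2.2
      simp only [jb, Prod.mk_sub_mk, Int.cast_sub] at this
      linarith
    by_cases hT : k1 ∈ T
    · rw [Set.indicator_of_mem hT]
      rcases le_total j k with hjk | hjk
      · have : Prod.mk k1 ⁻¹' E ⊆ Set.Icc (- a * (k1 : ℝ) ^ 2 - 2 ^ (j + 1)) (- a * (k1 : ℝ) ^ 2 + 2 ^ (j + 1)) := by
          intro t ht
          have := abs_le.1 (hj t ht)
          constructor <;> linarith
        refine (measure_mono this).trans ?_
        rw [Real.volume_Icc]
        apply ENNReal.ofReal_le_ofReal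
        simp only [l, min_eq_left hjk, pow_succ]
        linarith
      · have : Prod.mk k1 ⁻¹' E ⊆ Set.Icc (τ + a * ((n : ℝ) - k1) ^ 2 - 2 ^ (k + 1)) (τ + a * ((n : ℝ) - k1) ^ 2 + 2 ^ (k + 1)) := by
          intro t ht
          have := abs_le.1 (hk t ht)
          constructor <;> linarith
        refine (measure_mono this).trans ?_
        rw [Real.volume_Icc]
        apply ENNReal.ofReal_le_ofReal
        simp only [l, min_eq_right hjk, pow_succ]
        linarith
    · rw [Set.indicator_of_notMem hT]
      have : Prod.mk k1 ⁻¹' E = ∅ := by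
        rw [Set.eq_empty_iff_forall_notMem]
        intro t ht
        apply hT
        have h1 := (abs_add_le _ _).trans (add_le_add (hj t ht) (hk t ht))
        have e : t + a * (k1 : ℝ) ^ 2 + (τ - t + a * ((n : ℝ) - k1) ^ 2) =
          τ + a * ((k1 : ℝ) ^ 2 + ((n : ℝ) - k1) ^ 2) := by ring
        rw [e] at h1
        refine h1.trans ?_
        have i1 : (2 : ℝ) ^ j ≤ 2 ^ (max j k) := pow_le_pow_right₀ (by norm_num) (le_max_left _ _)
        have i2 : (2 : ℝ) ^ k ≤ 2 ^ (max j k) := pow_le_pow_right₀ (by norm_num) (le_max_right _ _)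
        simp only [M, pow_add]
        linarith
      simp [this]
  unfold muG
  rw [Measure.prod_apply hE]
  refine (lintegral_mono hsl).trans ?_
  rw [lintegral_indicator_const MeasurableSet.of_discrete]
  have hM : 1 ≤ M := one_le_pow₀ (by norm_num)
  refine (mul_le_mul_right (count_quad a ha n τ M hM) _).trans ?_
  rw [← ENNReal.ofReal_mul (by positivity)]
  apply ENNReal.ofReal_le_ofReal
  have : √M = 2 * √(2 ^ (max j k)) := by
    simp only [M]
    rw [pow_add, Real.sqrt_mul (by positivity), mul_comm]
    congr 1
    rw [show (2 : ℝ) ^ 2 = 2 ^ 2 from rfl, Real.sqrt_sq (by norm_num)]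
  rw [this]
  simp only [l]
  apply le_of_eq
  ring

lemma geom_dist (r : ℝ≥0∞) (j : ℕ) : ∑' k : ℕ, r ^ (Nat.dist j k) ≤ 2 * ∑' m : ℕ, r ^ m := by
  have h := Summable.sum_add_tsum_nat_add' (f := fun k : ℕ => r ^ (Nat.dist j k)) (k := j)
    ENNReal.summable
  rw [← h, two_mul]
  refine add_le_add ?_ ?_
  · rw [← Finset.sum_range_reflect]
    refine le_trans (le_of_eq ?_) ((ENNReal.sum_le_tsum (Finset.range j)).trans
      (ENNReal.tsum_comp_le_tsum_of_injective (f := fun m : ℕ => m + 1) (add_left_injective 1)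
        (fun m => r ^ m)))
    refine Finset.sum_congr rfl fun k hk => ?_
    have := Finset.mem_range.1 hk
    congr 1
    simp only [Nat.dist]
    omega
  · refine ENNReal.tsum_le_tsum fun k => ?_
    apply le_of_eq
    congr 1
    simp only [Nat.dist]
    omega

lemma Ad_exists (a : ℝ) (p : ℤ × ℝ) : ∃ J, p ∈ Ad a J ∧ ∀ j, p ∈ Ad a j → j = J := by
  have h1 : 1 ≤ jb (p.2 + a * (p.1 : ℝ) ^ 2) := by simp [jb]
  obtain ⟨J, hJ1, hJ2⟩ := exists_nat_pow_near h1 (one_lt_two)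
  refine ⟨J, ⟨hJ1, hJ2⟩, fun j hj => ?_⟩
  have a1 := (pow_lt_pow_iff_right₀ (one_lt_two (α := ℝ))).1 (hj.1.trans_lt hJ2)
  have a2 := (pow_lt_pow_iff_right₀ (one_lt_two (α := ℝ))).1 (hJ1.trans_lt hj.2)
  omega

lemma const_id (K0 : ℝ) (hK : 0 ≤ K0) (j k : ℕ) :
    K0 * (2 ^ (min j k) * √(2 ^ (max j k))) =
      (√K0 * ((2 : ℝ) ^ (-(1/8) : ℝ)) ^ (Nat.dist j k)) ^ 2 *
        (((2 : ℝ) ^ (3/4 : ℝ)) ^ j * ((2 : ℝ) ^ (3/4 : ℝ)) ^ k) := by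
  wlog hjk : j ≤ k generalizing j k
  · rw [min_comm, max_comm, Nat.dist_comm, this k j (by omega)]; ring
  obtain ⟨m, rfl⟩ := Nat.exists_eq_add_of_le hjk
  have hd : Nat.dist j (j + m) = m := by simp only [Nat.dist]; omega
  rw [hd, min_eq_left hjk, max_eq_right hjk, mul_pow, Real.sq_sqrt hK]
  have e1 : √((2 : ℝ) ^ (j + m)) = √2 ^ (j + m) := by
    rw [Real.sqrt_eq_iff_mul_self_eq (by positivity) (by positivity), ← mul_pow,
      Real.mul_self_sqrt (by norm_num)]
  have e2 : ((2 : ℝ) ^ (3/4 : ℝ)) ^ 2 = 2 * √2 := by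
    rw [← Real.rpow_natCast, ← Real.rpow_mul (by norm_num), Real.sqrt_eq_rpow]
    nth_rw 2 [← Real.rpow_one 2]
    rw [← Real.rpow_add (by norm_num)]
    norm_num
  have e3 : ((2 : ℝ) ^ (-(1/8) : ℝ)) ^ 2 * (2 : ℝ) ^ (3/4 : ℝ) = √2 := by
    rw [← Real.rpow_natCast, ← Real.rpow_mul (by norm_num), Real.sqrt_eq_rpow,
      ← Real.rpow_add (by norm_num)]
    norm_num
  rw [e1]
  set s := (2 : ℝ) ^ (3/4 : ℝ)
  set ρ := (2 : ℝ) ^ (-(1/8) : ℝ)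
  have : (ρ ^ m) ^ 2 * (s ^ j * s ^ (j + m)) = (s ^ 2) ^ j * (ρ ^ 2 * s) ^ m := by ring
  rw [mul_assoc, this, e2, e3]
  ring

theorem core (a : ℝ) (ha : a ≠ 0) : ∃ K : ℝ≥0∞, K ≠ ⊤ ∧ ∀ f : ℤ × ℝ → ℝ≥0∞, Measurable f →
    ∫⁻ ξ, (∫⁻ η, f η * f (ξ - η) ∂muG) ^ 2 ∂muG ≤
      K * (∫⁻ ξ, ENNReal.ofReal (jb (ξ.2 + a * (ξ.1 : ℝ) ^ 2) ^ (3/4 : ℝ)) * f ξ ^ 2 ∂muG) ^ 2 := by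
  set K0 := 8 * (4 * √(1 / |a|) + 2)
  have hK0 : 0 ≤ K0 := by positivity
  set ρ := (2 : ℝ) ^ (-(1/8) : ℝ)
  have hρ0 : 0 < ρ := by positivity
  have hρ1 : ρ < 1 := Real.rpow_lt_one_of_one_lt_of_neg (by norm_num) (by norm_num)
  set r : ℝ≥0∞ := ENNReal.ofReal ρ
  have hr : r < 1 := by rw [← ENNReal.ofReal_one]; exact (ENNReal.ofReal_lt_ofReal_iff (by norm_num)).2 hρ1
  set R : ℝ≥0∞ := 2 * ∑' m : ℕ, r ^ m
  have hR : R ≠ ⊤ := by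
    apply ENNReal.mul_ne_top (by norm_num)
    rw [ENNReal.tsum_geometric]
    exact ENNReal.inv_ne_top.2 (tsub_pos_of_lt hr).ne'
  set c := ENNReal.ofReal (√K0)
  refine ⟨(c * (2 * R)) ^ 2, ENNReal.pow_ne_top (ENNReal.mul_ne_top ENNReal.ofReal_ne_top
    (ENNReal.mul_ne_top (by norm_num) hR)), fun f hf => ?_⟩
  set g : ℕ → ℤ × ℝ → ℝ≥0∞ := fun j => (Ad a j).indicator f
  have hg : ∀ j, Measurable (g j) := fun j => hf.indicator (measurableSet_Ad a j)
  have hsum : ∀ p, f p = ∑' j, g j p := by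
    intro p
    obtain ⟨J, hJ, hu⟩ := Ad_exists a p
    rw [tsum_eq_single J]
    · simp [g, hJ]
    · intro j hj
      exact Set.indicator_of_notMem (fun h => hj (hu j h)) _
  set N : ℕ → ℝ≥0∞ := fun j => ∫⁻ ξ, g j ξ ^ 2 ∂muG
  set s := (2 : ℝ) ^ (3/4 : ℝ)
  have hs0 : 0 < s := by positivity
  set B : ℕ → ℝ≥0∞ := fun j => ENNReal.ofReal (s ^ j) * N j
  have hsubm : ∀ ξ : ℤ × ℝ, Measurable fun η : ℤ × ℝ => ξ - η := fun ξ =>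
    measurable_const.sub measurable_id
  have hF : ∀ ξ, (∫⁻ η, f η * f (ξ - η) ∂muG) =
      ∑' p : ℕ × ℕ, ∫⁻ η, g p.1 η * g p.2 (ξ - η) ∂muG := by
    intro ξ
    rw [← lintegral_tsum]
    · refine lintegral_congr fun η => ?_
      rw [hsum η, hsum (ξ - η), ENNReal.tsum_prod', ← ENNReal.tsum_mul_right]
      simp_rw [ENNReal.tsum_mul_left]
    · intro p
      exact ((hg p.1).mul ((hg p.2).comp (hsubm ξ))).aemeasurable
  have hFm : ∀ p : ℕ × ℕ, Measurable fun ξ => ∫⁻ η, g p.1 η * g p.2 (ξ - η) ∂muG := by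
    intro p
    apply Measurable.lintegral_prod_right' (f := fun q : (ℤ × ℝ) × (ℤ × ℝ) => g p.1 q.2 * g p.2 (q.1 - q.2))
    exact ((hg p.1).comp measurable_snd).mul ((hg p.2).comp (measurable_fst.sub measurable_snd))
  simp_rw [hF]
  refine (mink muG _ hFm).trans ?_
  rw [← mul_pow]
  gcongr
  have hpair : ∀ p : ℕ × ℕ, (∫⁻ ξ, (∫⁻ η, g p.1 η * g p.2 (ξ - η) ∂muG) ^ 2 ∂muG) ^ (1/2 : ℝ) ≤
      c * (r ^ (Nat.dist p.1 p.2) * (B p.1 + B p.2)) := by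
    rintro ⟨j, k⟩
    have h := conv_L2 muG (g j) (g k) (hg j) (hg k) (Ad a j) (Ad a k) (measurableSet_Ad a j)
      (measurableSet_Ad a k) (fun x hx => Set.indicator_of_notMem hx _)
      (fun x hx => Set.indicator_of_notMem hx _) _ (Ad_measure a ha j k)
    have h2 : ENNReal.ofReal (K0 * (2 ^ (min j k) * √(2 ^ (max j k)))) * (N j * N k) =
        (c * r ^ (Nat.dist j k)) ^ 2 * (B j * B k) := by
      rw [const_id K0 hK0, ENNReal.ofReal_mul (by positivity), ENNReal.ofReal_pow (by positivity),
        ENNReal.ofReal_mul (by positivity), ENNReal.ofReal_mul (by positivity),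
        ENNReal.ofReal_pow hρ0.le]
      simp only [B]
      ring
    have h3 := h.trans (le_of_eq h2)
    have h4 : B j * B k ≤ (B j + B k) ^ 2 := by
      rw [sq]; gcongr
      · exact le_self_add
      · exact le_add_self
    have h5 := h3.trans (mul_le_mul_right h4 _)
    rw [← mul_pow, mul_assoc] at h5
    refine (ENNReal.rpow_le_rpow h5 (by norm_num)).trans (le_of_eq ?_)
    rw [← ENNReal.rpow_natCast, ← ENNReal.rpow_mul]
    norm_num
  refine (ENNReal.tsum_le_tsum hpair).trans ?_
  rw [ENNReal.tsum_mul_left, mul_assoc]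
  gcongr
  have hB : ∑' j, B j ≤ ∫⁻ ξ, ENNReal.ofReal (jb (ξ.2 + a * (ξ.1 : ℝ) ^ 2) ^ (3/4 : ℝ)) * f ξ ^ 2 ∂muG := by
    simp only [B, N]
    simp_rw [← lintegral_const_mul _ ((hg _).pow_const 2)]
    rw [← lintegral_tsum (fun j => (((hg j).pow_const 2).const_mul _).aemeasurable)]
    refine lintegral_mono fun p => ?_
    obtain ⟨J, hJ, hu⟩ := Ad_exists a p
    rw [tsum_eq_single J]
    · simp only [g, Set.indicator_of_mem hJ]
      gcongr
      refine le_trans (le_of_eq ?_) (Real.rpow_le_rpow (by positivity) hJ.1 (by norm_num))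
      simp only [s]
      rw [← Real.rpow_natCast, ← Real.rpow_natCast, ← Real.rpow_mul (by norm_num),
        ← Real.rpow_mul (by norm_num), mul_comm]
    · intro j hj
      simp only [g]
      rw [Set.indicator_of_notMem (fun h => hj (hu j h))]
      simp
  refine le_trans ?_ (mul_le_mul_right hB _)
  rw [ENNReal.tsum_prod']
  simp_rw [mul_add, ENNReal.tsum_add]
  have hone : ∑' j, ∑' k, r ^ (Nat.dist j k) * B j ≤ R * ∑' j, B j := by
    rw [← ENNReal.tsum_mul_left]
    refine ENNReal.tsum_le_tsum fun j => ?_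
    rw [ENNReal.tsum_mul_right]
    gcongr
    exact geom_dist r j
  have htwo : ∑' j, ∑' k, r ^ (Nat.dist j k) * B k ≤ R * ∑' j, B j := by
    rw [ENNReal.tsum_comm]
    simp_rw [Nat.dist_comm]
    exact hone
  rw [two_mul, add_mul]
  exact add_le_add hone htwo

section fin
open SchwartzMap FourierTransform

lemma lintegral_muG (h : ℤ × ℝ → ℝ≥0∞) (hh : Measurable h) :
    ∫⁻ p, h p ∂muG = ∑' n : ℤ, ∫⁻ ξ, h (n, ξ) := by
  unfold muG
  rw [lintegral_prod _ hh.aemeasurable, lintegral_count]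

lemma int_exp (k : ℤ) : ∫ x in (0 : ℝ)..(2 * Real.pi), Complex.exp (Complex.I * k * x) =
    if k = 0 then (2 * Real.pi : ℂ) else 0 := by
  split_ifs with h
  · subst h; simp
  · have hk : Complex.I * (k : ℂ) ≠ 0 := mul_ne_zero Complex.I_ne_zero (by exact_mod_cast h)
    rw [integral_exp_mul_complex hk]
    have : Complex.exp (Complex.I * k * ((2 * Real.pi : ℝ) : ℂ)) = 1 := by
      rw [Complex.exp_eq_one_iff]
      exact ⟨k, by push_cast; ring⟩
    rw [this]; simp

lemma fin_parseval (T : Finset ℤ) (d : ℤ → ℂ) :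
    ∫⁻ x in Set.Ioc 0 (2 * Real.pi), ‖∑ m ∈ T, d m * Complex.exp (Complex.I * m * x)‖ₑ ^ 2 =
      ENNReal.ofReal (2 * Real.pi) * ∑ m ∈ T, ‖d m‖ₑ ^ 2 := by
  have hcont : Continuous fun x : ℝ => ∑ m ∈ T, d m * Complex.exp (Complex.I * m * x) := by fun_prop
  have h1 : ∫ x in (0 : ℝ)..(2 * Real.pi), ‖∑ m ∈ T, d m * Complex.exp (Complex.I * m * x)‖ ^ 2 =
      (2 * Real.pi) * ∑ m ∈ T, ‖d m‖ ^ 2 := by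
    apply Complex.ofReal_injective
    rw [← intervalIntegral.integral_ofReal]
    have e : ∀ x : ℝ, ((‖∑ m ∈ T, d m * Complex.exp (Complex.I * m * x)‖ ^ 2 : ℝ) : ℂ) =
        ∑ m ∈ T, ∑ l ∈ T, d m * (starRingEnd ℂ (d l)) * Complex.exp (Complex.I * (m - l : ℤ) * x) := by
      intro x
      push_cast
      rw [← Complex.mul_conj', map_sum, Finset.sum_mul_sum]
      refine Finset.sum_congr rfl fun m _ => Finset.sum_congr rfl fun l _ => ?_
      rw [map_mul, ← Complex.exp_conj]
      have : Complex.exp (Complex.I * ((m : ℂ) - l) * x) =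
          Complex.exp (Complex.I * m * x) * Complex.exp (starRingEnd ℂ (Complex.I * l * x)) := by
        rw [← Complex.exp_add]
        congr 1
        simp
        ring
      rw [this]; ring
    simp_rw [e]
    rw [intervalIntegral.integral_finsetSum]
    · have : ∀ m ∈ T, ∫ x in (0 : ℝ)..(2 * Real.pi), ∑ l ∈ T, d m * (starRingEnd ℂ (d l)) * Complex.exp (Complex.I * (m - l : ℤ) * x)
          = (2 * Real.pi) * ‖d m‖ ^ 2 := by
        intro m hm
        rw [intervalIntegral.integral_finsetSum]
        · simp_rw [intervalIntegral.integral_const_mul, int_exp, sub_eq_zero]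
          rw [Finset.sum_eq_single m]
          · simp [Complex.mul_conj']; ring
          · intro l _ hl
            simp [hl.symm]
          · intro h; exact absurd hm h
        · intro l _
          apply Continuous.intervalIntegrable
          fun_prop
      rw [Finset.sum_congr rfl this, ← Finset.mul_sum]
      push_cast
      rfl
    · intro l _
      apply Continuous.intervalIntegrable
      fun_prop
  rw [intervalIntegral.integral_of_le (by positivity)] at h1
  have h2 := ofReal_integral_eq_lintegral_ofReal (μ := volume.restrict (Set.Ioc 0 (2 * Real.pi)))
    (f := fun x : ℝ => ‖∑ m ∈ T, d m * Complex.exp (Complex.I * m * x)‖ ^ 2)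
    ((Continuous.integrableOn_Ioc (by fun_prop))) (ae_of_all _ fun x => by positivity)
  rw [h1] at h2
  have e3 : ∀ z : ℂ, ENNReal.ofReal (‖z‖ ^ 2) = ‖z‖ₑ ^ 2 := fun z => by
    rw [ENNReal.ofReal_pow (norm_nonneg _), ofReal_norm]
  simp_rw [e3] at h2
  rw [← h2, ENNReal.ofReal_mul (by positivity), ENNReal.ofReal_sum_of_nonneg (fun _ _ => by positivity)]
  simp_rw [e3]

lemma plancherel_l (f : 𝓢(ℝ, ℂ)) : ∫⁻ ξ, ‖𝓕 f ξ‖ₑ ^ 2 = ∫⁻ x, ‖f x‖ₑ ^ 2 := by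
  have e3 : ∀ z : ℂ, ENNReal.ofReal (‖z‖ ^ 2) = ‖z‖ₑ ^ 2 := fun z => by
    rw [ENNReal.ofReal_pow (norm_nonneg _), ofReal_norm]
  have key : ∀ g : 𝓢(ℝ, ℂ), ∫⁻ x, ‖g x‖ₑ ^ 2 = ENNReal.ofReal (∫ x, ‖g x‖ ^ 2) := by
    intro g
    rw [ofReal_integral_eq_lintegral_ofReal]
    · simp_rw [e3]
    · exact (g.memLp ((2 : ℕ) : ℝ≥0∞) volume).integrable_norm_pow (by norm_num)
    · exact ae_of_all _ fun x => by positivity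
  rw [key, key, integral_norm_sq_fourier]

lemma ff (f : 𝓢(ℝ, ℂ)) (x : ℝ) : 𝓕 (𝓕 f) x = f (-x) := by
  have h : 𝓕⁻ (𝓕 f) (-x) = f (-x) := by rw [FourierTransform.fourierInv_fourier_eq]
  rw [← h, SchwartzMap.fourierInv_coe, Real.fourierInv_eq_fourier_neg, neg_neg, SchwartzMap.fourier_coe]

theorem L4fin (a : ℝ) (ha : a ≠ 0) : ∃ K : ℝ≥0∞, K ≠ ⊤ ∧ ∀ (S : Finset ℤ) (c : ℤ → 𝓢(ℝ, ℂ)),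
    ∫⁻ t : ℝ, ∫⁻ x in Set.Ioc 0 (2 * Real.pi), ‖∑ n ∈ S, c n t * Complex.exp (Complex.I * n * x)‖ₑ ^ 4 ≤
      K * (∑ n ∈ S, ∫⁻ ξ, ENNReal.ofReal (jb (ξ + a * (n : ℝ) ^ 2) ^ (3/4 : ℝ)) * ‖𝓕 (c n) ξ‖ₑ ^ 2) ^ 2 := by
  obtain ⟨K, hK, hcore⟩ := core a ha
  refine ⟨ENNReal.ofReal (2 * Real.pi) * K, ENNReal.mul_ne_top ENNReal.ofReal_ne_top hK, fun S c => ?_⟩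
  classical
  set T := (S ×ˢ S).image (fun p => p.1 + p.2)
  set P : ℤ → Finset (ℤ × ℤ) := fun m => (S ×ˢ S).filter (fun p => p.1 + p.2 = m)
  set d : ℤ → ℝ → ℂ := fun m t => ∑ p ∈ P m, c p.1 t * c p.2 t
  have hsq : ∀ t x : ℝ, (∑ n ∈ S, c n t * Complex.exp (Complex.I * n * x)) ^ 2 =
      ∑ m ∈ T, d m t * Complex.exp (Complex.I * m * x) := by
    intro t x
    rw [sq, Finset.sum_mul_sum, ← Finset.sum_product',
      ← Finset.sum_fiberwise_of_maps_to (t := T) (g := fun p => p.1 + p.2)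
        (fun p hp => Finset.mem_image_of_mem _ hp)]
    refine Finset.sum_congr rfl fun m _ => ?_
    rw [Finset.sum_mul]
    refine Finset.sum_congr rfl fun p hp => ?_
    have := (Finset.mem_filter.1 hp).2
    rw [← this]
    have : Complex.exp (Complex.I * ((p.1 + p.2 : ℤ) : ℂ) * x) =
      Complex.exp (Complex.I * p.1 * x) * Complex.exp (Complex.I * p.2 * x) := by
      rw [← Complex.exp_add]; congr 1; push_cast; ring
    rw [this]; ring
  have h4 : ∀ t x : ℝ, ‖∑ n ∈ S, c n t * Complex.exp (Complex.I * n * x)‖ₑ ^ 4 =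
      ‖∑ m ∈ T, d m t * Complex.exp (Complex.I * m * x)‖ₑ ^ 2 := by
    intro t x
    rw [← hsq, enorm_pow, ← pow_mul]
  simp_rw [h4, fin_parseval]
  have hdm : ∀ m, Measurable fun t => ‖d m t‖ₑ ^ 2 := by
    intro m
    have : Continuous fun t => d m t :=
      continuous_finsetSum _ fun p _ => (c p.1).continuous.mul (c p.2).continuous
    exact (this.measurable.enorm).pow_const 2
  rw [lintegral_const_mul _ (Finset.measurable_sum _ fun m _ => hdm m),
    lintegral_finsetSum _ (fun m _ => hdm m), mul_assoc]
  gcongr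
  set f : ℤ × ℝ → ℝ≥0∞ := fun p => if p.1 ∈ S then ‖𝓕 (c p.1) p.2‖ₑ else 0
  have hf : Measurable f := by
    apply measurable_from_prod_countable_right
    intro n
    simp only [f]
    split_ifs
    · exact (𝓕 (c n)).continuous.measurable.enorm
    · exact measurable_const
  have hw : ∫⁻ ξ, ENNReal.ofReal (jb (ξ.2 + a * (ξ.1 : ℝ) ^ 2) ^ (3/4 : ℝ)) * f ξ ^ 2 ∂muG =
      ∑ n ∈ S, ∫⁻ ξ, ENNReal.ofReal (jb (ξ + a * (n : ℝ) ^ 2) ^ (3/4 : ℝ)) * ‖𝓕 (c n) ξ‖ₑ ^ 2 := by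
    rw [lintegral_muG (fun ξ => ENNReal.ofReal (jb (ξ.2 + a * (ξ.1 : ℝ) ^ 2) ^ (3/4 : ℝ)) * f ξ ^ 2) ((((measurable_w a).pow_const _).ennreal_ofReal).mul (hf.pow_const 2))]
    rw [tsum_eq_sum (s := S)]
    · refine Finset.sum_congr rfl fun n hn => ?_
      simp only [f, if_pos hn]
    · intro n hn
      simp [f, hn]
  rw [← hw]
  refine le_trans ?_ (hcore f hf)
  set B := ContinuousLinearMap.mul ℂ ℂ
  set H : ℤ → 𝓢(ℝ, ℂ) := fun m => ∑ p ∈ P m, SchwartzMap.convolution B (𝓕 (c p.1)) (𝓕 (c p.2))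
  have hFm : Measurable fun ξ : ℤ × ℝ => ∫⁻ η, f η * f (ξ - η) ∂muG := by
    apply Measurable.lintegral_prod_right' (f := fun q : (ℤ × ℝ) × (ℤ × ℝ) => f q.2 * f (q.1 - q.2))
    exact (hf.comp measurable_snd).mul (hf.comp (measurable_fst.sub measurable_snd))
  rw [lintegral_muG _ (hFm.pow_const 2)]
  refine le_trans ?_ (ENNReal.sum_le_tsum T)
  refine Finset.sum_le_sum fun m _ => ?_
  have hHd : ∀ t, 𝓕 (H m) t = d m (-t) := by
    intro t
    have : 𝓕 (H m) = ∑ p ∈ P m, 𝓕 (SchwartzMap.convolution B (𝓕 (c p.1)) (𝓕 (c p.2))) :=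
      map_sum (FourierTransform.fourierCLM ℂ 𝓢(ℝ, ℂ)) _ _
    rw [this, sum_apply]
    refine Finset.sum_congr rfl fun p _ => ?_
    rw [fourier_convolution, pairing_apply_apply, ff, ff]
    rfl
  have e1 : ∫⁻ t, ‖d m t‖ₑ ^ 2 = ∫⁻ ξ, ‖H m ξ‖ₑ ^ 2 := by
    rw [← plancherel_l]
    simp_rw [hHd]
    exact (lintegral_neg_eq_self (fun t => ‖d m t‖ₑ ^ 2)).symm
  rw [e1]
  refine lintegral_mono fun ξ => ?_
  gcongr
  have hsubm : Measurable fun η : ℤ × ℝ => (m, ξ) - η := measurable_const.sub measurable_id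
  rw [lintegral_muG (fun η => f η * f ((m, ξ) - η)) (hf.mul (hf.comp hsubm))]
  set G : ℤ → ℝ≥0∞ := fun k => ∫⁻ η : ℝ, f (k, η) * f (m - k, ξ - η)
  have hG : ∑' k : ℤ, ∫⁻ η : ℝ, f (k, η) * f ((m, ξ) - (k, η)) = ∑' k, G k := rfl
  refine le_trans ?_ (le_of_eq hG.symm)
  have hinj : Set.InjOn (fun p : ℤ × ℤ => p.1) (P m) := by
    intro p hp q hq hpq
    have h1 := (Finset.mem_filter.1 hp).2
    have h2 := (Finset.mem_filter.1 hq).2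
    simp only at hpq
    ext
    · exact hpq
    · linarith
  have : ‖H m ξ‖ₑ ≤ ∑ p ∈ P m, G p.1 := by
    simp only [H]
    rw [sum_apply]
    refine (enorm_sum_le _ _).trans (Finset.sum_le_sum fun p hp => ?_)
    rw [SchwartzMap.convolution_apply, convolution_def]
    refine (enorm_integral_le_lintegral_enorm _).trans (le_of_eq ?_)
    refine lintegral_congr fun η => ?_
    have h0 := Finset.mem_filter.1 hp
    have h1 := (Finset.mem_product.1 h0.1)
    have h2 : m - p.1 = p.2 := by linarith [h0.2]
    simp only [f, h2, if_pos h1.1, if_pos h1.2, B, ContinuousLinearMap.mul_apply', enorm_mul]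
  refine this.trans ?_
  rw [← Finset.sum_image (f := G) hinj]
  exact ENNReal.sum_le_tsum _

end fin

section five
open FourierTransform SchwartzMap Topology

structure Good (u : ℝ × ℝ → ℂ) : Prop where
  smooth : ContDiff ℝ (⊤ : ℕ∞) u
  per : ∀ t x : ℝ, u (t, x + 2 * Real.pi) = u (t, x)
  supp : ∃ R : ℝ, ∀ t x : ℝ, R < |t| → u (t, x) = 0

noncomputable def dtt (u : ℝ × ℝ → ℂ) (p : ℝ × ℝ) : ℂ := fderiv ℝ u p (1, 0)
noncomputable def dxx (u : ℝ × ℝ → ℂ) (p : ℝ × ℝ) : ℂ := fderiv ℝ u p (0, 1)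

lemma dtt_smooth {u : ℝ × ℝ → ℂ} (h : ContDiff ℝ (⊤ : ℕ∞) u) : ContDiff ℝ (⊤ : ℕ∞) (dtt u) := by
  have := h.fderiv_right (m := (⊤ : ℕ∞)) (by simp)
  exact this.clm_apply contDiff_const

lemma dxx_smooth {u : ℝ × ℝ → ℂ} (h : ContDiff ℝ (⊤ : ℕ∞) u) : ContDiff ℝ (⊤ : ℕ∞) (dxx u) := by
  have := h.fderiv_right (m := (⊤ : ℕ∞)) (by simp)
  exact this.clm_apply contDiff_const

lemma hasDeriv_t {u : ℝ × ℝ → ℂ} (h : ContDiff ℝ (⊤ : ℕ∞) u) (t x : ℝ) :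
    HasDerivAt (fun t => u (t, x)) (dtt u (t, x)) t := by
  have h1 : HasFDerivAt u (fderiv ℝ u (t, x)) (t, x) :=
    (h.differentiable (by simp)).differentiableAt.hasFDerivAt
  exact h1.comp_hasDerivAt t ((hasDerivAt_id t).prodMk (hasDerivAt_const t x))

lemma hasDeriv_x {u : ℝ × ℝ → ℂ} (h : ContDiff ℝ (⊤ : ℕ∞) u) (t x : ℝ) :
    HasDerivAt (fun x => u (t, x)) (dxx u (t, x)) x := by
  have h1 : HasFDerivAt u (fderiv ℝ u (t, x)) (t, x) :=
    (h.differentiable (by simp)).differentiableAt.hasFDerivAt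
  exact h1.comp_hasDerivAt x ((hasDerivAt_const x t).prodMk (hasDerivAt_id x))

lemma Good.dtt {u : ℝ × ℝ → ℂ} (h : Good u) : Good (dtt u) := by
  refine ⟨dtt_smooth h.smooth, fun t x => ?_, ?_⟩
  · have h1 := hasDeriv_t h.smooth t (x + 2 * Real.pi)
    simp_rw [h.per] at h1
    exact h1.unique (hasDeriv_t h.smooth t x)
  · obtain ⟨R, hR⟩ := h.supp
    refine ⟨R, fun t x ht => ?_⟩
    have h1 := hasDeriv_t h.smooth t x
    have h2 : (fun t => u (t, x)) =ᶠ[𝓝 t] fun _ => 0 := by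
      filter_upwards [(isOpen_lt continuous_const continuous_abs).mem_nhds ht] with s hs
      exact hR s x hs
    exact (h1.congr_of_eventuallyEq h2.symm).unique (hasDerivAt_const t 0)

lemma Good.dxx {u : ℝ × ℝ → ℂ} (h : Good u) : Good (dxx u) := by
  refine ⟨dxx_smooth h.smooth, fun t x => ?_, ?_⟩
  · have h1 := hasDeriv_x h.smooth t (x + 2 * Real.pi)
    have h3 := HasDerivAt.scomp (h := fun y => y + 2 * Real.pi) x h1 ((hasDerivAt_id x).add_const (2 * Real.pi))
    have h4 : ((fun x => u (t, x)) ∘ fun y => y + 2 * Real.pi) = fun x => u (t, x) := by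
      ext y; simp [h.per]
    rw [h4] at h3
    simpa using h3.unique (hasDeriv_x h.smooth t x)
  · obtain ⟨R, hR⟩ := h.supp
    refine ⟨R, fun t x ht => ?_⟩
    have h1 := hasDeriv_x h.smooth t x
    have h2 : (fun x => u (t, x)) = fun _ => 0 := by ext y; exact hR t y ht
    rw [h2] at h1
    exact h1.unique (hasDerivAt_const x 0)

lemma param_deriv {w : ℝ × ℝ → ℂ} (h : ContDiff ℝ (⊤ : ℕ∞) w) (t : ℝ) :
    HasDerivAt (fun t => ∫ x in (0 : ℝ)..(2 * Real.pi), w (t, x))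
      (∫ x in (0 : ℝ)..(2 * Real.pi), dtt w (t, x)) t := by
  have hc := h.continuous
  have hc' := (dtt_smooth h).continuous
  obtain ⟨M, hM⟩ := ((isCompact_closedBall t 1).prod
    (isCompact_Icc (a := (0 : ℝ)) (b := 2 * Real.pi))).exists_bound_of_continuousOn hc'.continuousOn
  refine (intervalIntegral.hasDerivAt_integral_of_dominated_loc_of_deriv_le
    (F := fun t x => w (t, x)) (F' := fun t x => dtt w (t, x)) (bound := fun _ => M)
    (Metric.closedBall_mem_nhds t one_pos) ?_ ?_ ?_ ?_ ?_ ?_).2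
  · exact Filter.Eventually.of_forall fun s => by
      apply Continuous.aestronglyMeasurable; fun_prop
  · apply Continuous.intervalIntegrable; fun_prop
  · apply Continuous.aestronglyMeasurable; fun_prop
  · refine Filter.Eventually.of_forall fun x hx s hs => hM (s, x) ⟨hs, ?_⟩
    rw [Set.uIoc_of_le (by positivity)] at hx
    exact ⟨hx.1.le, hx.2⟩
  · simp
  · exact Filter.Eventually.of_forall fun x hx s hs => hasDeriv_t h s x

lemma param_smooth (w : ℝ × ℝ → ℂ) (h : ContDiff ℝ (⊤ : ℕ∞) w) :
    ContDiff ℝ (⊤ : ℕ∞) (fun t => ∫ x in (0 : ℝ)..(2 * Real.pi), w (t, x)) := by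
  rw [contDiff_infty]
  intro n
  induction n generalizing w with
  | zero =>
    have : Differentiable ℝ (fun t => ∫ x in (0 : ℝ)..(2 * Real.pi), w (t, x)) :=
      fun t => (param_deriv h t).differentiableAt
    simpa using this.continuous
  | succ n ih =>
    push_cast
    rw [contDiff_succ_iff_deriv]
    refine ⟨fun t => (param_deriv h t).differentiableAt, by simp, ?_⟩
    rw [show deriv (fun t => ∫ x in (0 : ℝ)..(2 * Real.pi), w (t, x)) =
      fun t => ∫ x in (0 : ℝ)..(2 * Real.pi), dtt w (t, x) from
      funext fun t => (param_deriv h t).deriv]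
    exact ih _ (dtt_smooth h)

noncomputable def cf (u : ℝ × ℝ → ℂ) (n : ℤ) (t : ℝ) : ℂ :=
  (2 * Real.pi : ℂ)⁻¹ * ∫ x in (0 : ℝ)..(2 * Real.pi), u (t, x) * Complex.exp (-Complex.I * n * x)

lemma tw_smooth {u : ℝ × ℝ → ℂ} (h : ContDiff ℝ (⊤ : ℕ∞) u) (n : ℤ) :
    ContDiff ℝ (⊤ : ℕ∞) (fun p : ℝ × ℝ => u p * Complex.exp (-Complex.I * n * p.2)) := by
  refine h.mul ?_
  apply ContDiff.cexp
  refine contDiff_const.mul ?_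
  exact Complex.ofRealCLM.contDiff.comp contDiff_snd

lemma cf_smooth {u : ℝ × ℝ → ℂ} (h : Good u) (n : ℤ) : ContDiff ℝ (⊤ : ℕ∞) (cf u n) :=
  contDiff_const.mul (param_smooth _ (tw_smooth h.smooth n))

lemma cf_deriv {u : ℝ × ℝ → ℂ} (h : Good u) (n : ℤ) : deriv (cf u n) = cf (dtt u) n := by
  ext t
  have h1 := (param_deriv (tw_smooth h.smooth n) t).const_mul (2 * Real.pi : ℂ)⁻¹
  have : ∀ x, _root_.dtt (fun p : ℝ × ℝ => u p * Complex.exp (-Complex.I * n * p.2)) (t, x) =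
      dtt u (t, x) * Complex.exp (-Complex.I * n * x) := fun x =>
    (hasDeriv_t (tw_smooth h.smooth n) t x).unique ((hasDeriv_t h.smooth t x).mul_const (Complex.exp (-Complex.I * n * x)))
  simp_rw [this] at h1
  exact h1.deriv

lemma cf_supp {u : ℝ × ℝ → ℂ} {R : ℝ} (hR : ∀ t x : ℝ, R < |t| → u (t, x) = 0) (n : ℤ) (t : ℝ)
    (ht : R < |t|) : cf u n t = 0 := by
  simp [cf, hR t _ ht]

lemma cf_compact {u : ℝ × ℝ → ℂ} (h : Good u) (n : ℤ) : HasCompactSupport (cf u n) := by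
  obtain ⟨R, hR⟩ := h.supp
  refine HasCompactSupport.intro (isCompact_Icc (a := -R) (b := R)) fun t ht => ?_
  apply cf_supp hR
  by_contra hh
  exact ht (abs_le.mp (not_lt.mp hh))

noncomputable def cS {u : ℝ × ℝ → ℂ} (h : Good u) (n : ℤ) : 𝓢(ℝ, ℂ) :=
  (cf_compact h n).toSchwartzMap (cf_smooth h n)

lemma cS_apply {u : ℝ × ℝ → ℂ} (h : Good u) (n : ℤ) (t : ℝ) : cS h n t = cf u n t := rfl

lemma ft_cf (u : ℝ × ℝ → ℂ) (n : ℤ) (ξ : ℝ) : 𝓕 (cf u n) ξ = ftper u (2 * Real.pi * ξ) n := by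
  rw [Real.fourier_real_eq_integral_exp_smul, ftper, ← integral_const_mul]
  congr 1 with t
  rw [cf, smul_eq_mul, mul_left_comm, ← intervalIntegral.integral_const_mul]
  congr 2 with x
  rw [mul_left_comm, ← Complex.exp_add]
  congr 2
  push_cast; ring

lemma cS_fourier {u : ℝ × ℝ → ℂ} (h : Good u) (n : ℤ) (ξ : ℝ) :
    𝓕 (cS h n) ξ = ftper u (2 * Real.pi * ξ) n := by
  rw [← ft_cf, SchwartzMap.fourier_coe]; rfl

lemma ftper_cont {u : ℝ × ℝ → ℂ} (h : Good u) (n : ℤ) : Continuous fun τ => ftper u τ n := by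
  have : (fun τ => ftper u τ n) = fun τ => 𝓕 (cS h n) (τ / (2 * Real.pi)) := by
    ext τ
    rw [cS_fourier]
    congr 1
    field_simp
  rw [this]
  exact (𝓕 (cS h n)).continuous.comp (by fun_prop)

lemma good_bdd {u : ℝ × ℝ → ℂ} (h : Good u) : ∃ M R : ℝ, 0 ≤ M ∧ 0 ≤ R ∧
    (∀ t, ∀ x ∈ Set.Icc 0 (2 * Real.pi), ‖u (t, x)‖ ≤ M) ∧ ∀ t x : ℝ, R < |t| → u (t, x) = 0 := by
  obtain ⟨R, hR⟩ := h.supp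
  obtain ⟨M, hM⟩ := ((isCompact_Icc (a := -R) (b := R)).prod
    (isCompact_Icc (a := (0 : ℝ)) (b := 2 * Real.pi))).exists_bound_of_continuousOn
    h.smooth.continuous.continuousOn
  refine ⟨max M 0, max R 0, le_max_right _ _, le_max_right _ _, fun t x hx => ?_, fun t x ht =>
    hR t x (lt_of_le_of_lt (le_max_left _ _) ht)⟩
  by_cases ht : R < |t|
  · rw [hR t x ht]; simp
  · exact (hM (t, x) ⟨abs_le.mp (not_lt.mp ht), hx⟩).trans (le_max_left _ _)

lemma cf_bdd {u : ℝ × ℝ → ℂ} (h : Good u) : ∃ M, 0 ≤ M ∧ ∀ n t, ‖cf u n t‖ ≤ M := by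
  obtain ⟨M, R, hM0, -, hM, -⟩ := good_bdd h
  refine ⟨M, hM0, fun n t => ?_⟩
  have : ‖∫ x in (0 : ℝ)..(2 * Real.pi), u (t, x) * Complex.exp (-Complex.I * n * x)‖ ≤
      M * |2 * Real.pi - 0| := by
    apply intervalIntegral.norm_integral_le_of_norm_le_const
    intro x hx
    rw [Set.uIoc_of_le (by positivity)] at hx
    have e : ‖Complex.exp (-Complex.I * n * x)‖ = 1 := by
      rw [show -Complex.I * n * x = ((-n * x : ℝ) : ℂ) * Complex.I by push_cast; ring]
      exact Complex.norm_exp_ofReal_mul_I _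
    rw [norm_mul, e, mul_one]
    exact hM t x ⟨hx.1.le, hx.2⟩
  have hp := Real.pi_pos
  rw [cf, norm_mul, norm_inv, show ‖(2 * Real.pi : ℂ)‖ = 2 * Real.pi by
    simp [abs_of_pos hp]]
  rw [sub_zero, abs_of_pos (by positivity)] at this
  calc _ ≤ (2 * Real.pi)⁻¹ * (M * (2 * Real.pi)) := by gcongr
    _ = M := by field_simp

lemma ft_bdd {u : ℝ × ℝ → ℂ} (h : Good u) : ∃ M, 0 ≤ M ∧ ∀ n τ, ‖ftper u τ n‖ ≤ M := by
  obtain ⟨M, hM0, hM⟩ := cf_bdd h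
  obtain ⟨-, R, -, hR0, -, hR⟩ := good_bdd h
  refine ⟨M * (2 * R), by positivity, fun n τ => ?_⟩
  have e : ftper u τ n = 𝓕 (cf u n) (τ / (2 * Real.pi)) := by
    rw [ft_cf]; congr 1; field_simp
  rw [e]
  rw [Real.fourier_real_eq_integral_exp_smul]
  refine (norm_integral_le_integral_norm _).trans ?_
  simp_rw [norm_smul, Complex.norm_exp_ofReal_mul_I, one_mul]
  have h1 : ∀ t, ‖cf u n t‖ ≤ (Set.Icc (-R) R).indicator (fun _ => M) t := by
    intro t
    by_cases ht : t ∈ Set.Icc (-R) R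
    · rw [Set.indicator_of_mem ht]; exact hM n t
    · rw [Set.indicator_of_notMem ht, cf_supp hR n t]
      · simp
      · by_contra hh; exact ht (abs_le.mp (not_lt.mp hh))
  calc _ ≤ ∫ t, (Set.Icc (-R) R).indicator (fun _ => M) t := by
        apply integral_mono_of_nonneg (Filter.Eventually.of_forall fun t => norm_nonneg _) _
          (Filter.Eventually.of_forall h1)
        rw [integrable_indicator_iff measurableSet_Icc]
        exact integrableOn_const (by simp) (by simp)
    _ = M * (2 * R) := by
        rw [integral_indicator measurableSet_Icc, setIntegral_const]
        simp [Measure.real]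
        rw [ENNReal.toReal_ofReal (by linarith)]; ring

lemma cf_dxx {u : ℝ × ℝ → ℂ} (h : Good u) (n : ℤ) (t : ℝ) :
    cf (dxx u) n t = Complex.I * n * cf u n t := by
  have hd : ∀ x : ℝ, HasDerivAt (fun x : ℝ => Complex.exp (-Complex.I * n * x))
      (-Complex.I * n * Complex.exp (-Complex.I * n * x)) x := by
    intro x
    have := ((hasDerivAt_id (x : ℂ)).const_mul (-Complex.I * n)).cexp.comp_ofReal
    simpa [mul_comm] using this
  have h1 := intervalIntegral.integral_mul_deriv_eq_deriv_mul (a := 0) (b := 2 * Real.pi)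
    (u := fun x => u (t, x)) (u' := fun x => dxx u (t, x))
    (v := fun x : ℝ => Complex.exp (-Complex.I * n * x)) 
    (v' := fun x : ℝ => -Complex.I * n * Complex.exp (-Complex.I * n * x))
    (fun x _ => hasDeriv_x h.smooth t x) (fun x _ => hd x)
    (by have := (dxx_smooth h.smooth).continuous
        apply Continuous.intervalIntegrable; fun_prop)
    (by apply Continuous.intervalIntegrable; fun_prop)
  have hp := h.per t 0
  rw [zero_add] at hp
  have he : Complex.exp (-Complex.I * n * ((2 * Real.pi : ℝ) : ℂ)) = 1 := by
    rw [Complex.exp_eq_one_iff]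
    exact ⟨-n, by push_cast; ring⟩
  rw [hp, he] at h1
  simp only [Complex.ofReal_zero, mul_zero, Complex.exp_zero, sub_self, zero_sub] at h1
  have h2 : ∫ x in (0 : ℝ)..(2 * Real.pi), u (t, x) * (-Complex.I * n * Complex.exp (-Complex.I * n * x))
     = -Complex.I * n * ∫ x in (0 : ℝ)..(2 * Real.pi), u (t, x) * Complex.exp (-Complex.I * n * x) := by
    rw [← intervalIntegral.integral_const_mul]
    congr 1 with x; ring
  rw [h2] at h1
  rw [cf, cf, ← neg_eq_iff_eq_neg.mpr h1]
  ring

lemma ft_dxx {u : ℝ × ℝ → ℂ} (h : Good u) (n : ℤ) (τ : ℝ) :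
    ftper (dxx u) τ n = Complex.I * n * ftper u τ n := by
  have e : ∀ v, ftper v τ n = 𝓕 (cf v n) (τ / (2 * Real.pi)) := fun v => by
    rw [ft_cf]; congr 1; field_simp
  rw [e, e, Real.fourier_real_eq_integral_exp_smul, Real.fourier_real_eq_integral_exp_smul,
    ← integral_const_mul]
  congr 1 with t
  rw [cf_dxx h, smul_eq_mul, smul_eq_mul]; ring

lemma ft_dtt {u : ℝ × ℝ → ℂ} (h : Good u) (n : ℤ) (τ : ℝ) :
    ftper (dtt u) τ n = Complex.I * τ * ftper u τ n := by
  have e : ∀ v, ftper v τ n = 𝓕 (cf v n) (τ / (2 * Real.pi)) := fun v => by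
    rw [ft_cf]; congr 1; field_simp
  rw [e, e, ← cf_deriv h, Real.fourier_deriv]
  · simp only [smul_eq_mul]
    push_cast
    field_simp
  · exact (cS h n).integrable
  · exact (cf_smooth h n).differentiable (by simp)
  · rw [cf_deriv h]; exact (cS h.dtt n).integrable

lemma ft_decay {u : ℝ × ℝ → ℂ} (h : Good u) : ∃ M, 0 ≤ M ∧ ∀ (n : ℤ) (τ : ℝ),
    (1 + τ ^ 2) * (1 + (n : ℝ) ^ 4) * ‖ftper u τ n‖ ≤ M := by
  obtain ⟨M1, h1, H1⟩ := ft_bdd h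
  obtain ⟨M2, h2, H2⟩ := ft_bdd h.dtt.dtt
  obtain ⟨M3, h3, H3⟩ := ft_bdd h.dxx.dxx.dxx.dxx
  obtain ⟨M4, h4, H4⟩ := ft_bdd h.dxx.dxx.dxx.dxx.dtt.dtt
  refine ⟨M1 + M2 + M3 + M4, by positivity, fun n τ => ?_⟩
  have e1 := H1 n τ
  have e2 := H2 n τ
  have e3 := H3 n τ
  have e4 := H4 n τ
  rw [ft_dtt h.dtt, ft_dtt h] at e2
  rw [ft_dxx h.dxx.dxx.dxx, ft_dxx h.dxx.dxx, ft_dxx h.dxx, ft_dxx h] at e3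
  rw [ft_dtt h.dxx.dxx.dxx.dxx.dtt, ft_dtt h.dxx.dxx.dxx.dxx,
    ft_dxx h.dxx.dxx.dxx, ft_dxx h.dxx.dxx, ft_dxx h.dxx, ft_dxx h] at e4
  simp only [norm_mul, Complex.norm_I, one_mul, Complex.norm_intCast, Complex.norm_real,
    Real.norm_eq_abs] at e2 e3 e4
  have a1 : |τ| * (|τ| * ‖ftper u τ n‖) = τ ^ 2 * ‖ftper u τ n‖ := by
    rw [← sq_abs τ]; ring
  have a2 : ∀ y : ℝ, |(n : ℝ)| * (|(n : ℝ)| * (|(n : ℝ)| * (|(n : ℝ)| * y))) = (n : ℝ) ^ 4 * y := by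
    intro y
    rw [← (Even.pow_abs (by decide : Even 4) (n : ℝ))]; ring
  have a3 : ∀ y : ℝ, |τ| * (|τ| * y) = τ ^ 2 * y := by
    intro y
    rw [← sq_abs τ]; ring
  rw [a3] at e2 e4
  rw [a2] at e3 e4
  nlinarith

end five

section six
open FourierTransform SchwartzMap Topology

lemma summable_inv_sq : Summable fun n : ℤ => (1 + (n : ℝ) ^ 2)⁻¹ := by
  have h1 : Summable fun n : ℤ => 1 / (n : ℝ) ^ 2 := Real.summable_one_div_int_pow.mpr (by norm_num)
  refine Summable.of_norm_bounded_eventually h1 ?_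
  have : ({0}ᶜ : Set ℤ) ∈ (Filter.cofinite : Filter ℤ) := (Set.finite_singleton (0 : ℤ)).compl_mem_cofinite
  filter_upwards [this] with n hn
  have hn' : (n : ℝ) ≠ 0 := by exact_mod_cast hn
  rw [Real.norm_of_nonneg (by positivity), one_div]
  gcongr
  linarith

lemma cf_summable {u : ℝ × ℝ → ℂ} (h : Good u) (t : ℝ) : Summable fun n => cf u n t := by
  obtain ⟨M1, h1, H1⟩ := cf_bdd h
  obtain ⟨M2, h2, H2⟩ := cf_bdd h.dxx.dxx
  refine Summable.of_norm_bounded (summable_inv_sq.mul_left (M1 + M2)) fun n => ?_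
  have e1 := H1 n t
  have e2 := H2 n t
  rw [cf_dxx h.dxx, cf_dxx h] at e2
  simp only [norm_mul, Complex.norm_I, one_mul, Complex.norm_intCast] at e2
  have a3 : ∀ y : ℝ, |(n : ℝ)| * (|(n : ℝ)| * y) = (n : ℝ) ^ 2 * y := by
    intro y
    rw [← sq_abs (n : ℝ)]; ring
  rw [a3] at e2
  rw [← div_eq_mul_inv, le_div_iff₀ (by positivity)]
  linarith

lemma u_hasSum {u : ℝ × ℝ → ℂ} (h : Good u) (t x : ℝ) :
    HasSum (fun n : ℤ => cf u n t * Complex.exp (Complex.I * n * x)) (u (t, x)) := by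
  have : Fact (0 < 2 * Real.pi) := ⟨by positivity⟩
  have hper : Function.Periodic (fun x => u (t, x)) (2 * Real.pi) := fun x => h.per t x
  have hc := h.smooth.continuous
  let f : C(AddCircle (2 * Real.pi), ℂ) := ⟨hper.lift, by
    refine continuous_quot_lift _ ?_
    fun_prop⟩
  have hf : ∀ y : ℝ, f (y : AddCircle (2 * Real.pi)) = u (t, y) := fun y => rfl
  have hp : (Real.pi : ℂ) ≠ 0 := by exact_mod_cast Real.pi_ne_zero
  have hcf : ∀ n, fourierCoeff f n = cf u n t := by
    intro n
    rw [fourierCoeff_eq_intervalIntegral _ _ 0, cf, zero_add]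
    rw [Complex.real_smul]
    congr 1
    · push_cast; simp
    · congr 1 with y
      rw [hf, fourier_coe_apply, smul_eq_mul, mul_comm]
      congr 2
      push_cast
      field_simp
  have hs : Summable (fourierCoeff f) := by
    rw [show fourierCoeff f = fun n => cf u n t from funext hcf]
    exact cf_summable h t
  have := has_pointwise_sum_fourier_series_of_summable hs (x : AddCircle (2 * Real.pi))
  rw [hf] at this
  convert this using 2 with n
  rw [hcf, fourier_coe_apply, smul_eq_mul]
  congr 2
  push_cast
  field_simp

lemma jb_one_le (x : ℝ) : 1 ≤ jb x := by unfold jb; linarith [abs_nonneg x]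

lemma weight_bound {u : ℝ × ℝ → ℂ} (h : Good u) (φ : ℤ → ℝ) (c : ℝ) (hc : 0 ≤ c)
    (hφ : ∀ n, |φ n| ≤ c * (n : ℝ) ^ 2) : ∃ M, 0 ≤ M ∧ ∀ (n : ℤ) (τ : ℝ),
    jb (τ + φ n) ^ (3/4 : ℝ) * ‖ftper u τ n‖ ^ 2 ≤ (M * (1 + (n : ℝ) ^ 2)⁻¹) * (1 + τ ^ 2)⁻¹ := by
  obtain ⟨M, hM0, hM⟩ := ft_decay h
  refine ⟨(2 + c) * M ^ 2, by positivity, fun n τ => ?_⟩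
  have h1 : jb (τ + φ n) ^ (3/4 : ℝ) ≤ jb (τ + φ n) := by
    conv_rhs => rw [← Real.rpow_one (jb (τ + φ n))]
    exact Real.rpow_le_rpow_of_exponent_le (jb_one_le _) (by norm_num)
  have h2 : jb (τ + φ n) ≤ (2 + c) * ((1 + τ ^ 2) * (1 + (n : ℝ) ^ 2)) := by
    unfold jb
    have a1 := abs_add_le τ (φ n)
    have a2 := hφ n
    have a3 : |τ| ≤ 1 + τ ^ 2 := by
      rw [← sq_abs]; nlinarith [sq_nonneg (|τ| - 1), abs_nonneg τ]
    have a4 : 0 ≤ τ ^ 2 * (n : ℝ) ^ 2 := by positivity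
    have a5 : 0 ≤ c * (τ ^ 2 * (n : ℝ) ^ 2) := by positivity
    have a6 : 0 ≤ c * τ ^ 2 := by positivity
    nlinarith [sq_nonneg τ, sq_nonneg (n : ℝ)]
  have h3 : 1 + (n : ℝ) ^ 2 ≤ 1 + (n : ℝ) ^ 4 := by
    have : (n : ℤ) ^ 2 ≤ n ^ 4 := by
      rcases eq_or_ne n 0 with rfl | hn
      · simp
      · have : 1 ≤ n ^ 2 := Int.add_one_le_iff.mpr (sq_pos_of_ne_zero hn)
        nlinarith
    have : (n : ℝ) ^ 2 ≤ (n : ℝ) ^ 4 := by exact_mod_cast this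
    linarith
  have h4 : ((1 + τ ^ 2) * (1 + (n : ℝ) ^ 2)) * ‖ftper u τ n‖ ≤ M := by
    refine le_trans ?_ (hM n τ)
    gcongr
  set P := (1 + τ ^ 2) * (1 + (n : ℝ) ^ 2) with hP
  have hPpos : 0 < P := by positivity
  have h5 : (P * ‖ftper u τ n‖) ^ 2 ≤ M ^ 2 := by gcongr
  rw [mul_assoc, ← mul_inv, mul_comm (1 + (n : ℝ) ^ 2), ← hP, ← div_eq_mul_inv, le_div_iff₀ hPpos]
  calc _ ≤ (2 + c) * P * ‖ftper u τ n‖ ^ 2 * P := by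
        gcongr; exact h1.trans h2
    _ = (2 + c) * (P * ‖ftper u τ n‖) ^ 2 := by ring
    _ ≤ _ := by gcongr

lemma jb_cont : Continuous jb := by unfold jb; fun_prop

lemma jbw_cont (y : ℝ) : Continuous fun τ => jb (τ + y) ^ (3/4 : ℝ) :=
  Continuous.rpow_const (jb_cont.comp (by fun_prop)) fun x =>
    Or.inl (by linarith [jb_one_le (x + y)])

lemma tsum_conv {u : ℝ × ℝ → ℂ} (h : Good u) (φ : ℤ → ℝ) (c : ℝ) (hc : 0 ≤ c)
    (hφ : ∀ n, |φ n| ≤ c * (n : ℝ) ^ 2) :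
    ∑' n : ℤ, ∫⁻ τ, ENNReal.ofReal (jb (τ + φ n) ^ (3/4 : ℝ)) * ‖ftper u τ n‖ₑ ^ 2 =
      ENNReal.ofReal (∑' n : ℤ, ∫ τ, jb (τ + φ n) ^ (3/4 : ℝ) * ‖ftper u τ n‖ ^ 2) := by
  obtain ⟨M, hM0, hM⟩ := weight_bound h φ c hc hφ
  have hnn : ∀ n τ, 0 ≤ jb (τ + φ n) ^ (3/4 : ℝ) * ‖ftper u τ n‖ ^ 2 := fun n τ =>
    mul_nonneg (Real.rpow_nonneg (by linarith [jb_one_le (τ + φ n)]) _) (by positivity)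
  have hbi : ∀ n : ℤ, Integrable fun τ : ℝ => (M * (1 + (n : ℝ) ^ 2)⁻¹) * (1 + τ ^ 2)⁻¹ :=
    fun n => integrable_inv_one_add_sq.const_mul _
  have hIntg : ∀ n, Integrable fun τ => jb (τ + φ n) ^ (3/4 : ℝ) * ‖ftper u τ n‖ ^ 2 := by
    intro n
    refine (hbi n).mono' ?_ (Filter.Eventually.of_forall fun τ => ?_)
    · exact ((jbw_cont _).mul ((ftper_cont h n).norm.pow 2)).aestronglyMeasurable
    · rw [Real.norm_of_nonneg (hnn n τ)]; exact hM n τ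
  rw [ENNReal.ofReal_tsum_of_nonneg (fun n => integral_nonneg (hnn n))]
  · congr 1 with n
    rw [ofReal_integral_eq_lintegral_ofReal (hIntg n) (Filter.Eventually.of_forall (hnn n))]
    congr 1 with τ
    rw [ENNReal.ofReal_mul (Real.rpow_nonneg (by linarith [jb_one_le (τ + φ n)]) _),
      ENNReal.ofReal_pow (norm_nonneg _), ofReal_norm]
  · have : Summable fun n : ℤ => (1 + (n : ℝ) ^ 2)⁻¹ * (M * ∫ τ : ℝ, (1 + τ ^ 2)⁻¹) :=
      summable_inv_sq.mul_right _
    refine Summable.of_nonneg_of_le (fun n => integral_nonneg (hnn n)) (fun n => ?_) this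
    calc _ ≤ ∫ τ : ℝ, (M * (1 + (n : ℝ) ^ 2)⁻¹) * (1 + τ ^ 2)⁻¹ := integral_mono (hIntg n) (hbi n) (hM n)
      _ = _ := by rw [integral_const_mul]; ring

lemma jb_scale (ξ y : ℝ) : jb (ξ + y / (2 * Real.pi)) ≤ jb (2 * Real.pi * ξ + y) := by
  have hp := Real.pi_gt_three
  have : 2 * Real.pi * ξ + y = 2 * Real.pi * (ξ + y / (2 * Real.pi)) := by field_simp
  rw [this]
  unfold jb
  rw [abs_mul, abs_of_pos (by positivity : 0 < 2 * Real.pi)]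
  nlinarith [abs_nonneg (ξ + y / (2 * Real.pi))]

lemma term_scale {u : ℝ × ℝ → ℂ} (h : Good u) (n : ℤ) (y z : ℝ) (hz : z = y / (2 * Real.pi)) :
    ∫⁻ ξ, ENNReal.ofReal (jb (ξ + z) ^ (3/4 : ℝ)) * ‖𝓕 (cS h n) ξ‖ₑ ^ 2 ≤
    ∫⁻ τ, ENNReal.ofReal (jb (τ + y) ^ (3/4 : ℝ)) * ‖ftper u τ n‖ₑ ^ 2 := by
  subst hz
  set F : ℝ → ℝ≥0∞ := fun τ => ENNReal.ofReal (jb (τ + y) ^ (3/4 : ℝ)) * ‖ftper u τ n‖ₑ ^ 2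
  have hF : Measurable F := by
    have h1 := (jbw_cont y).measurable
    have h2 := (ftper_cont h n).measurable
    fun_prop
  calc _ ≤ ∫⁻ ξ, F (2 * Real.pi * ξ) := by
        apply lintegral_mono; intro ξ
        simp only [F]
        rw [cS_fourier]
        gcongr
        · linarith [jb_one_le (ξ + y / (2 * Real.pi))]
        · exact jb_scale ξ y
    _ = ∫⁻ τ, F τ ∂(Measure.map (2 * Real.pi * ·) volume) := by
        rw [lintegral_map hF (by fun_prop)]
    _ = ENNReal.ofReal |(2 * Real.pi)⁻¹| * ∫⁻ τ, F τ := by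
        rw [Real.map_volume_mul_left (by positivity), lintegral_smul_measure]; rfl
    _ ≤ 1 * ∫⁻ τ, F τ := by
        gcongr
        rw [ENNReal.ofReal_le_one, abs_of_pos (by positivity)]
        apply inv_le_one_of_one_le₀
        linarith [Real.pi_gt_three]
    _ = _ := one_mul _

lemma pow4_add (a b : ℝ≥0∞) : (a + b) ^ 4 ≤ 16 * (a ^ 4 + b ^ 4) := by
  rcases le_total a b with hab | hab
  · calc (a + b) ^ 4 ≤ (b + b) ^ 4 := by gcongr
      _ = 16 * b ^ 4 := by ring
      _ ≤ _ := by gcongr; exact le_add_self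
  · calc (a + b) ^ 4 ≤ (a + a) ^ 4 := by gcongr
      _ = 16 * a ^ 4 := by ring
      _ ≤ _ := by gcongr; exact le_self_add

lemma main_l (cp cm : ℝ) (hp : cp ≠ 0) (hm : cm ≠ 0) (φ : ℤ → ℝ)
    (h1 : ∀ n : ℤ, 0 ≤ n → φ n = cp * (n : ℝ) ^ 2) (h2 : ∀ n : ℤ, ¬ 0 ≤ n → φ n = cm * (n : ℝ) ^ 2) :
    ∃ K : ℝ≥0∞, K ≠ ⊤ ∧ ∀ u, Good u → 
    ∫⁻ t : ℝ, ∫⁻ x in Set.Ioc 0 (2 * Real.pi), ‖u (t, x)‖ₑ ^ 4 ≤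
      K * (∑' n : ℤ, ∫⁻ τ, ENNReal.ofReal (jb (τ + φ n) ^ (3/4 : ℝ)) * ‖ftper u τ n‖ₑ ^ 2) ^ 2 := by
  have hpi := Real.pi_pos
  obtain ⟨Kp, hKp, HP⟩ := L4fin (cp / (2 * Real.pi)) (by positivity)
  obtain ⟨Km, hKm, HM⟩ := L4fin (cm / (2 * Real.pi)) (by positivity)
  refine ⟨16 * (Kp + Km), ENNReal.mul_ne_top (by norm_num) (by simp [hKp, hKm]), fun u hu => ?_⟩
  set Y := ∑' n : ℤ, ∫⁻ τ, ENNReal.ofReal (jb (τ + φ n) ^ (3/4 : ℝ)) * ‖ftper u τ n‖ₑ ^ 2 with hY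
  let f : Finset ℤ → ℝ × ℝ → ℂ := fun S p => ∑ n ∈ S, cS hu n p.1 * Complex.exp (Complex.I * n * p.2)
  have hfc : ∀ S, Continuous (f S) := by
    intro S
    have : ∀ n, Continuous (cS hu n) := fun n => (cS hu n).continuous
    fun_prop
  have hfm : ∀ S, Measurable fun p => ‖f S p‖ₑ ^ 4 := fun S => (hfc S).enorm.measurable.pow_const 4
  have hfm1 : ∀ S t, Measurable fun x => ‖f S (t, x)‖ₑ ^ 4 := fun S t =>
    (hfm S).comp measurable_prodMk_left
  have hfm2 : ∀ S, Measurable fun t => ∫⁻ x in Set.Ioc 0 (2 * Real.pi), ‖f S (t, x)‖ₑ ^ 4 :=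
    fun S => (hfm S).lintegral_prod_right'
  have hS : ∀ S : Finset ℤ, ∫⁻ t : ℝ, ∫⁻ x in Set.Ioc 0 (2 * Real.pi), ‖f S (t, x)‖ₑ ^ 4 ≤
      16 * (Kp + Km) * Y ^ 2 := by
    intro S
    set A := S.filter (0 ≤ ·)
    set B := S.filter (¬ 0 ≤ ·)
    have hA : ∫⁻ t : ℝ, ∫⁻ x in Set.Ioc 0 (2 * Real.pi), ‖f A (t, x)‖ₑ ^ 4 ≤ Kp * Y ^ 2 := by
      refine (HP A (cS hu)).trans ?_
      gcongr
      refine le_trans (Finset.sum_le_sum fun n hn => ?_) (ENNReal.sum_le_tsum A)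
      apply term_scale hu n
      rw [h1 n (Finset.mem_filter.mp hn).2]; ring
    have hB : ∫⁻ t : ℝ, ∫⁻ x in Set.Ioc 0 (2 * Real.pi), ‖f B (t, x)‖ₑ ^ 4 ≤ Km * Y ^ 2 := by
      refine (HM B (cS hu)).trans ?_
      gcongr
      refine le_trans (Finset.sum_le_sum fun n hn => ?_) (ENNReal.sum_le_tsum B)
      apply term_scale hu n
      rw [h2 n (Finset.mem_filter.mp hn).2]; ring
    calc _ ≤ ∫⁻ t : ℝ, ∫⁻ x in Set.Ioc 0 (2 * Real.pi),
            16 * (‖f A (t, x)‖ₑ ^ 4 + ‖f B (t, x)‖ₑ ^ 4) := by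
          apply lintegral_mono; intro t
          apply lintegral_mono; intro x
          refine le_trans ?_ (pow4_add _ _)
          dsimp only
          gcongr
          have : f S (t, x) = f A (t, x) + f B (t, x) :=
            (Finset.sum_filter_add_sum_filter_not S (0 ≤ ·) _).symm
          rw [this]
          exact enorm_add_le _ _
      _ = 16 * (∫⁻ t : ℝ, ∫⁻ x in Set.Ioc 0 (2 * Real.pi), ‖f A (t, x)‖ₑ ^ 4) +
          16 * (∫⁻ t : ℝ, ∫⁻ x in Set.Ioc 0 (2 * Real.pi), ‖f B (t, x)‖ₑ ^ 4) := by
          have : ∀ t : ℝ, ∫⁻ x in Set.Ioc 0 (2 * Real.pi),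
            16 * (‖f A (t, x)‖ₑ ^ 4 + ‖f B (t, x)‖ₑ ^ 4) =
            16 * ((∫⁻ x in Set.Ioc 0 (2 * Real.pi), ‖f A (t, x)‖ₑ ^ 4) +
            ∫⁻ x in Set.Ioc 0 (2 * Real.pi), ‖f B (t, x)‖ₑ ^ 4) := by
            intro t
            rw [lintegral_const_mul' _ _ (by norm_num), lintegral_add_left (hfm1 A t)]
          simp_rw [this]
          rw [lintegral_const_mul' _ _ (by norm_num), lintegral_add_left (hfm2 A), mul_add]
      _ ≤ 16 * (Kp * Y ^ 2) + 16 * (Km * Y ^ 2) := by gcongr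
      _ = _ := by ring
  let g : ℕ → Finset ℤ := fun N => Finset.Icc (-(N : ℤ)) N
  have hlim : ∀ t x : ℝ, ‖u (t, x)‖ₑ ^ 4 =
      Filter.liminf (fun N => ‖f (g N) (t, x)‖ₑ ^ 4) Filter.atTop := by
    intro t x
    have e1 : Filter.Tendsto (fun N => f (g N) (t, x)) Filter.atTop (𝓝 (u (t, x))) :=
      (u_hasSum hu t x).comp Finset.tendsto_Icc_neg
    exact (((ENNReal.continuous_pow 4).comp continuous_enorm).continuousAt.tendsto.comp e1).liminf_eq.symm
  calc _ = ∫⁻ t : ℝ, ∫⁻ x in Set.Ioc 0 (2 * Real.pi),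
        Filter.liminf (fun N => ‖f (g N) (t, x)‖ₑ ^ 4) Filter.atTop := by simp_rw [hlim]
    _ ≤ ∫⁻ t : ℝ, Filter.liminf (fun N => ∫⁻ x in Set.Ioc 0 (2 * Real.pi), ‖f (g N) (t, x)‖ₑ ^ 4)
        Filter.atTop := lintegral_mono fun t => lintegral_liminf_le fun N => hfm1 (g N) t
    _ ≤ Filter.liminf (fun N => ∫⁻ t : ℝ, ∫⁻ x in Set.Ioc 0 (2 * Real.pi), ‖f (g N) (t, x)‖ₑ ^ 4)
        Filter.atTop := lintegral_liminf_le fun N => hfm2 (g N)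
    _ ≤ _ := Filter.liminf_le_of_frequently_le' (Filter.Frequently.of_forall fun N => hS (g N))

lemma main_r (cp cm : ℝ) (hp : cp ≠ 0) (hm : cm ≠ 0) (φ : ℤ → ℝ)
    (h1 : ∀ n : ℤ, 0 ≤ n → φ n = cp * (n : ℝ) ^ 2) (h2 : ∀ n : ℤ, ¬ 0 ≤ n → φ n = cm * (n : ℝ) ^ 2) :
    ∃ C : ℝ, 0 < C ∧ ∀ u, Good u → 
    (∫ t : ℝ, ∫ x in (0 : ℝ)..(2 * Real.pi), ‖u (t, x)‖ ^ 4) ^ ((1 : ℝ)/4) ≤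
        C * (∑' n : ℤ, ∫ τ : ℝ, jb (τ + φ n) ^ (3/4 : ℝ) * ‖ftper u τ n‖ ^ 2)
          ^ ((1 : ℝ)/2) := by
  obtain ⟨K, hK, H⟩ := main_l cp cm hp hm φ h1 h2
  set k := K.toReal + 1 with hk
  have hk0 : 0 < k := by positivity
  refine ⟨k ^ ((1 : ℝ) / 4), by positivity, fun u hu => ?_⟩
  have hφ : ∀ n, |φ n| ≤ (|cp| + |cm|) * (n : ℝ) ^ 2 := by
    intro n
    by_cases hn : 0 ≤ n
    · rw [h1 n hn, abs_mul, abs_of_nonneg (sq_nonneg (n : ℝ))]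
      nlinarith [abs_nonneg cm, sq_nonneg (n : ℝ)]
    · rw [h2 n hn, abs_mul, abs_of_nonneg (sq_nonneg (n : ℝ))]
      nlinarith [abs_nonneg cp, sq_nonneg (n : ℝ)]
  have h3 := H u hu
  rw [tsum_conv hu φ _ (by positivity) hφ] at h3
  set X := ∑' n : ℤ, ∫ τ : ℝ, jb (τ + φ n) ^ (3/4 : ℝ) * ‖ftper u τ n‖ ^ 2 with hX
  have hX0 : 0 ≤ X := tsum_nonneg fun n => integral_nonneg fun τ =>
    mul_nonneg (Real.rpow_nonneg (by linarith [jb_one_le (τ + φ n)]) _) (by positivity)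
  set I := ∫ t : ℝ, ∫ x in (0 : ℝ)..(2 * Real.pi), ‖u (t, x)‖ ^ 4 with hI
  have hI0 : 0 ≤ I := integral_nonneg fun t =>
    intervalIntegral.integral_nonneg (by positivity) fun x _ => by positivity
  have h4 : ENNReal.ofReal I ≤ ∫⁻ t : ℝ, ∫⁻ x in Set.Ioc 0 (2 * Real.pi), ‖u (t, x)‖ₑ ^ 4 := by
    rw [← Real.enorm_of_nonneg hI0]
    refine (enorm_integral_le_lintegral_enorm _).trans (lintegral_mono fun t => ?_)
    rw [intervalIntegral.integral_of_le (by positivity)]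
    refine (enorm_integral_le_lintegral_enorm _).trans (lintegral_mono fun x => ?_)
    simp
  have h5 : I ≤ k * X ^ 2 := by
    rw [← ENNReal.ofReal_le_ofReal_iff (by positivity)]
    refine (h4.trans h3).trans ?_
    rw [ENNReal.ofReal_mul hk0.le, ENNReal.ofReal_pow hX0]
    gcongr
    rw [ENNReal.le_ofReal_iff_toReal_le hK hk0.le]
    linarith
  calc I ^ ((1 : ℝ) / 4) ≤ (k * X ^ 2) ^ ((1 : ℝ) / 4) := by gcongr
    _ = k ^ ((1 : ℝ) / 4) * X ^ ((1 : ℝ) / 2) := by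
      rw [Real.mul_rpow hk0.le (by positivity), ← Real.rpow_natCast X 2, ← Real.rpow_mul hX0]
      norm_num

end six

/-- Periodic Bourgain–Strichartz `L⁴` estimates: `‖u‖_{L⁴} ≲ ‖u‖_{X^{0,3/8}}` and
`‖u‖_{L⁴} ≲ ‖u‖_{Y_γ^{0,3/8}}`. -/
theorem periodic_L4_estimate (γ : ℝ) (hγ : γ ≠ 0) :
    ∃ C : ℝ, 0 < C ∧ ∀ u : ℝ × ℝ → ℂ, ContDiff ℝ (⊤ : ℕ∞) u →
      (∀ t x : ℝ, u (t, x + 2 * Real.pi) = u (t, x)) →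
      (∃ R : ℝ, ∀ t x : ℝ, R < |t| → u (t, x) = 0) →
      ((∫ t : ℝ, ∫ x in (0 : ℝ)..(2 * Real.pi), ‖u (t, x)‖ ^ 4) ^ ((1 : ℝ)/4) ≤
        C * (∑' n : ℤ, ∫ τ : ℝ, jb (τ + (n : ℝ) ^ 2) ^ (3/4 : ℝ) * ‖ftper u τ n‖ ^ 2)
          ^ ((1 : ℝ)/2)) ∧
      ((∫ t : ℝ, ∫ x in (0 : ℝ)..(2 * Real.pi), ‖u (t, x)‖ ^ 4) ^ ((1 : ℝ)/4) ≤
        C * (∑' n : ℤ, ∫ τ : ℝ,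
            jb (τ + γ * |(n : ℝ)| * (n : ℝ)) ^ (3/4 : ℝ) * ‖ftper u τ n‖ ^ 2)
          ^ ((1 : ℝ)/2)) := by
  obtain ⟨C1, hC1, H1⟩ := main_r 1 1 one_ne_zero one_ne_zero (fun n => (n : ℝ) ^ 2)
    (fun n _ => by simp) (fun n _ => by simp)
  obtain ⟨C2, hC2, H2⟩ := main_r γ (-γ) hγ (neg_ne_zero.mpr hγ) (fun n => γ * |(n : ℝ)| * (n : ℝ))
    (fun n hn => by
      have : (0 : ℝ) ≤ n := by exact_mod_cast hn
      simp only [abs_of_nonneg this]; ring)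
    (fun n hn => by
      have : (n : ℝ) < 0 := by exact_mod_cast not_le.mp hn
      simp only [abs_of_neg this]; ring)
  have hnn : ∀ (φ : ℤ → ℝ) (u : ℝ × ℝ → ℂ),
      0 ≤ (∑' n : ℤ, ∫ τ : ℝ, jb (τ + φ n) ^ (3/4 : ℝ) * ‖ftper u τ n‖ ^ 2) ^ ((1 : ℝ)/2) :=
    fun φ u => Real.rpow_nonneg (tsum_nonneg fun n => integral_nonneg fun τ =>
      mul_nonneg (Real.rpow_nonneg (by linarith [jb_one_le (τ + φ n)]) _) (by positivity)) _
  refine ⟨C1 + C2, by positivity, fun u hu hper hsupp => ⟨?_, ?_⟩⟩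
  · refine (H1 u ⟨hu, hper, hsupp⟩).trans ?_
    exact mul_le_mul_of_nonneg_right (by linarith) (hnn (fun n => (n : ℝ) ^ 2) u)
  · refine (H2 u ⟨hu, hper, hsupp⟩).trans ?_
    exact mul_le_mul_of_nonneg_right (by linarith) (hnn (fun n => γ * |(n : ℝ)| * (n : ℝ)) u)
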